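/- Let d ≥ 5 and let S ⊂ ℝ^d be a d-dimensional canonical lattice simplex such that the barycentric coordinates of the origin with respect to the vertices of S are (1/s_1, …, 1/s_{d-2}, 1/(3(s_{d-1}−1)), 1/(3(s_{d-1}−1)), 1/(3(s_{d-1}−1))). Then S is unimodularly equivalent to a lattice simplex conv{s_1 e_1, …, s_{d-2} e_{d-2}, a, b, c} for some a, b, c ∈ ℤ^d with a + b + c = 0, which contains e_1 + ⋯ + e_{d-2} as its unique interior lattice point. -/

import Mathlib

/-- Shifted Sylvester sequence: `sylv n` is the Sylvester number `s (n+1)`,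
so `sylv 0 = s 1 = 2`, `sylv 1 = s 2 = 3`, `sylv 2 = s 3 = 7`, `sylv 3 = s 4 = 43`, …
It satisfies `s (i+1) = s i * (s i - 1) + 1 = s 1 * ⋯ * s i + 1`. -/
def sylv : ℕ → ℕ
  | 0 => 2
  | n + 1 => sylv n * (sylv n - 1) + 1

/-- The canonical embedding of integer vectors into real vectors. -/
def toR {d : ℕ} (x : Fin d → ℤ) : Fin d → ℝ := fun j => (x j : ℝ)

/-- The lattice simplex (as a subset of `ℝ^d`) with vertex family `v`. -/
def hullOf {d : ℕ} (v : Fin (d + 1) → Fin d → ℤ) : Set (Fin d → ℝ) :=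
  convexHull ℝ (Set.range fun i => toR (v i))

/-- `v` is the vertex family of a `d`-dimensional canonical lattice simplex:
the vertices are affinely independent lattice points, the origin lies in the
interior, and the origin is the only lattice point in the interior. -/
def IsCanonicalSimplex {d : ℕ} (v : Fin (d + 1) → Fin d → ℤ) : Prop :=
  AffineIndependent ℝ (fun i => toR (v i)) ∧
  (0 : Fin d → ℝ) ∈ interior (hullOf v) ∧
  ∀ x : Fin d → ℤ, toR x ∈ interior (hullOf v) → x = 0

/-- Two subsets of `ℝ^d` are unimodularly equivalent if one is the image of the
other under `x ↦ A x + w` with `A ∈ GL_d(ℤ)` and `w ∈ ℤ^d`. -/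
def UnimodEquiv {d : ℕ} (Q Q' : Set (Fin d → ℝ)) : Prop :=
  ∃ (A : Matrix (Fin d) (Fin d) ℤ) (w : Fin d → ℤ), IsUnit A.det ∧
    Q' = (fun x => (A.map fun n : ℤ => (n : ℝ)).mulVec x + toR w) '' Q

/-- The vertex family of the simplex `conv{s_1 e_1, …, s_{d-2} e_{d-2}, a, b, c}`. -/
def simplexABC (d : ℕ) (a b c : Fin d → ℤ) : Fin (d + 1) → Fin d → ℤ := fun i j =>
  if (i : ℕ) < d - 2 then (if (j : ℕ) = (i : ℕ) then (sylv (i : ℕ) : ℤ) else 0)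
  else if (i : ℕ) = d - 2 then a j
  else if (i : ℕ) = d - 1 then b j
  else c j

theorem two_le_sylv (n : ℕ) : 2 ≤ sylv n := by
  induction n with
  | zero => simp [sylv]
  | succ n ih =>
    have : 1 ≤ sylv n - 1 := by omega
    simp only [sylv]
    nlinarith

theorem sylv_succ_cast {R : Type*} [CommRing R] (n : ℕ) :
    (sylv (n + 1) : R) - 1 = sylv n * (sylv n - 1) := by
  have := two_le_sylv n
  simp only [sylv]
  push_cast [Nat.cast_sub (show 1 ≤ sylv n by omega)]
  ring

theorem sum_inv_sylv {K : Type*} [Field K] [CharZero K] (n : ℕ) :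
    ∑ i : Fin n, ((sylv i : K))⁻¹ + ((sylv n : K) - 1)⁻¹ = 1 := by
  induction n with
  | zero => norm_num [sylv]
  | succ n ih =>
    have h := two_le_sylv n
    have h1 : (sylv n : K) ≠ 0 := by exact_mod_cast (by omega : sylv n ≠ 0)
    have h2 : (sylv n : K) - 1 ≠ 0 := sub_ne_zero.2 (by exact_mod_cast (by omega : sylv n ≠ 1))
    rw [Fin.sum_univ_castSucc, sylv_succ_cast]
    refine Eq.trans ?_ ih
    simp only [Fin.val_castSucc, Fin.val_last]
    field_simp
    ring

theorem sylv_sub_one_eq_mul {i n : ℕ} (hi : i < n) :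
    ∃ k : ℤ, (sylv n : ℤ) - 1 = sylv i * (sylv i * k - 1) := by
  induction n, hi using Nat.le_induction with
  | base => exact ⟨1, by rw [sylv_succ_cast]; ring⟩
  | succ n hn ih =>
    obtain ⟨k, hk⟩ := ih
    refine ⟨k + (sylv i * k - 1) ^ 2, ?_⟩
    rw [sylv_succ_cast, hk, ← sub_add_cancel (sylv n : ℤ) 1, hk]
    ring

theorem sylv_dvd_sub_one {i n : ℕ} (hi : i < n) : (sylv i : ℤ) ∣ sylv n - 1 := by
  obtain ⟨k, hk⟩ := sylv_sub_one_eq_mul hi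
  exact ⟨_, hk⟩

theorem isCoprime_sylv {i j : ℕ} (h : i ≠ j) : IsCoprime (sylv i : ℤ) (sylv j) := by
  wlog hij : i < j generalizing i j
  · exact (this h.symm (by omega)).symm
  obtain ⟨m, hm⟩ := sylv_dvd_sub_one hij
  exact ⟨-m, 1, by linear_combination hm⟩

theorem sylv_mul_sylv_dvd {i j n : ℕ} (h : i ≠ j) (hi : i < n) (hj : j < n) :
    (sylv i : ℤ) * sylv j ∣ sylv n - 1 :=
  (isCoprime_sylv h).mul_dvd (sylv_dvd_sub_one hi) (sylv_dvd_sub_one hj)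

/-- The lattice vectors pointing from the centroid `p` of the last three vertices to the others
are divisible by the corresponding Sylvester numbers. -/
theorem exists_centroid_and_directions {M : Type*} [AddCommGroup M] [Module.IsTorsionFree ℤ M]
    {n : ℕ} (v : Fin n → M) (t : M) (N : Fin n → ℤ)
    (hN : ∀ i : Fin n, sylv i * N i = (sylv n : ℤ) - 1) (hv : (3 : ℤ) • ∑ i, N i • v i + t = 0) :
    ∃ (p : M) (u : Fin n → M), (3 : ℤ) • p = t ∧
      (∀ i : Fin n, (sylv i : ℤ) • u i = v i - p) ∧ ∑ i, u i = -p := by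
  have hs (i : ℕ) : (sylv i : ℤ) ≠ 0 := by have := two_le_sylv i; omega
  have hpos : (sylv n : ℤ) - 1 ≠ 0 := by have := two_le_sylv n; omega
  have hu (i : Fin n) : ∃ u, (sylv i : ℤ) • u = v i - -∑ j, N j • v j := by
    obtain ⟨k, hk⟩ := sylv_sub_one_eq_mul i.2
    have hNi : N i = sylv i * k - 1 := mul_left_cancel₀ (hs i) (by rw [hN, hk])
    have hdvd (j : Fin n) (hj : j ≠ i) : (sylv i : ℤ) ∣ N j := by
      have := sylv_mul_sylv_dvd (fun h => hj (Fin.ext h)) j.2 i.2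
      rw [← hN j] at this
      exact Int.dvd_of_mul_dvd_mul_left (hs j) this
    choose! q hq using hdvd
    refine ⟨k • v i + ∑ j ∈ Finset.univ.erase i, q j • v j, ?_⟩
    rw [← Finset.add_sum_erase _ _ (Finset.mem_univ i), hNi, smul_add, Finset.smul_sum,
      Finset.sum_congr rfl fun j hj => by
        rw [smul_smul, ← hq j (Finset.ne_of_mem_erase hj)]]
    module
  choose u hu using hu
  refine ⟨-∑ j, N j • v j, u, ?_, hu, ?_⟩
  · rw [eq_comm, smul_neg, eq_neg_iff_add_eq_zero, add_comm, hv]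
  · have hsum : ∑ i, N i = (sylv n : ℤ) - 1 - 1 := by
      have h := sum_inv_sylv (K := ℚ) n
      have h0 : (sylv n : ℚ) - 1 ≠ 0 := by exact_mod_cast hpos
      have hi (i : Fin n) : (N i : ℚ) = (sylv n - 1) * (sylv i : ℚ)⁻¹ := by
        have h1 : (sylv i : ℚ) ≠ 0 := by exact_mod_cast hs i
        rw [eq_mul_inv_iff_mul_eq₀ h1, mul_comm]
        exact_mod_cast hN i
      have : (∑ i, (N i : ℚ)) = (sylv n - 1) - 1 := by
        simp_rw [hi, ← Finset.mul_sum]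
        rw [eq_sub_of_add_eq h]
        field_simp
      exact_mod_cast this
    refine smul_right_injective M hpos ?_
    simp only [Finset.smul_sum]
    rw [Finset.sum_congr rfl fun i _ => by
      rw [← hN i, mul_comm, mul_smul, hu i, smul_sub], Finset.sum_sub_distrib,
      ← Finset.sum_smul, hsum]
    module

theorem mem_interior_hullOf {d : ℕ} {v : Fin (d + 1) → Fin d → ℤ}
    (hv : AffineIndependent ℝ (fun i => toR (v i))) {w : Fin (d + 1) → ℝ} (hw : ∀ i, 0 < w i)
    (hsum : ∑ i, w i = 1) : ∑ i, w i • toR (v i) ∈ interior (hullOf v) := by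
  have htop : affineSpan ℝ (Set.range fun i => toR (v i)) = ⊤ := by
    rw [hv.affineSpan_eq_top_iff_card_eq_finrank_add_one]
    simp
  let b : AffineBasis (Fin (d + 1)) ℝ (Fin d → ℝ) := ⟨fun i => toR (v i), hv, htop⟩
  have hb : hullOf v = convexHull ℝ (Set.range b) := rfl
  rw [hb, b.interior_convexHull, ← Finset.affineCombination_eq_linear_combination _ _ _ hsum]
  intro i
  have := b.coord_apply_combination_of_mem (Finset.mem_univ i) hsum
  exact this ▸ hw i

/-- A linearly independent family spanning a saturated sublattice of `ℤ ^ (n + m)` can be mapped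
to the first standard basis vectors by a unimodular map. -/
theorem exists_linearEquiv_eq_single {n m : ℕ} (u : Fin n → Fin (n + m) → ℤ)
    (hu : LinearIndependent ℤ u)
    (hsat : ∀ (k : ℤ) (x : Fin (n + m) → ℤ), 0 < k → k • x ∈ Submodule.span ℤ (Set.range u) →
      x ∈ Submodule.span ℤ (Set.range u)) :
    ∃ E : (Fin (n + m) → ℤ) ≃ₗ[ℤ] (Fin (n + m) → ℤ),
      ∀ i, E (u i) = Pi.single (Fin.castAdd m i) 1 := by
  set W := Submodule.span ℤ (Set.range u)
  have htf : Module.IsTorsionFree ℤ ((Fin (n + m) → ℤ) ⧸ W) := by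
    refine Module.IsTorsionFree.of_smul_eq_zero fun k x h => ?_
    obtain ⟨x, rfl⟩ := W.mkQ_surjective x
    rw [or_iff_not_imp_left]
    intro hk
    rw [← map_smul] at h
    simp only [Submodule.mkQ_apply, Submodule.Quotient.mk_eq_zero] at h ⊢
    refine hsat |k| x (abs_pos.2 hk) ?_
    rcases abs_choice k with h' | h' <;> rw [h']
    · exact h
    · rw [neg_smul]; exact W.neg_mem h
  obtain ⟨r, bQ⟩ := Module.basisOfFiniteTypeTorsionFree' (R := ℤ) (M := (Fin (n + m) → ℤ) ⧸ W)
  let B := Module.Basis.sumQuot (Module.Basis.span hu) bQ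
  have hr : n + r = n + m := by
    have := Module.finrank_eq_card_basis B
    simpa using this.symm
  obtain rfl : r = m := by omega
  refine ⟨(B.reindex finSumFinEquiv).equivFun, fun i => ?_⟩
  have : u i = B.reindex finSumFinEquiv (Fin.castAdd r i) := by
    simp [B, Module.Basis.span_apply]
  ext j
  rw [this, Module.Basis.equivFun_self, Pi.single_apply]
  simp only [eq_comm]

theorem exists_matrix_of_linearEquiv {d : ℕ} (E : (Fin d → ℤ) ≃ₗ[ℤ] (Fin d → ℤ))
    (w : Fin d → ℤ) : ∃ (A : Matrix (Fin d) (Fin d) ℤ) (Φ : (Fin d → ℝ) ≃ᵃ[ℝ] (Fin d → ℝ)),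
      IsUnit A.det ∧ (⇑Φ = fun x => (A.map fun n : ℤ => (n : ℝ)).mulVec x + toR w) ∧
      ∀ x, Φ (toR x) = toR (E x + w) := by
  let A := LinearMap.toMatrix' (E : (Fin d → ℤ) →ₗ[ℤ] (Fin d → ℤ))
  have hA : IsUnit A.det := by
    rw [LinearMap.det_toMatrix']
    exact E.isUnit_det'
  let AR := A.map fun n : ℤ => (n : ℝ)
  have hAR : IsUnit AR.det := by
    have : AR.det = (A.det : ℝ) := (Int.cast_det A).symm
    rw [this]
    exact hA.map (Int.castRingHom ℝ)
  have hinv : Invertible AR := Matrix.invertibleOfIsUnitDet _ hAR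
  let Φ := (AR.toLinearEquiv' hinv).toAffineEquiv.trans (AffineEquiv.constVAdd ℝ _ (toR w))
  have hL (x) : AR.toLinearEquiv' hinv x = AR.mulVec x := rfl
  have hΦ : ⇑Φ = fun x => AR.mulVec x + toR w := by
    ext x
    simp [Φ, add_comm, hL]
  refine ⟨A, Φ, hA, hΦ, fun x => ?_⟩
  have hE : E x = A.mulVec x := by simp [A]
  rw [hΦ, hE]
  ext j
  simp [toR, AR, Matrix.mulVec, dotProduct]

/-- Points of the affine chart `p + ∑ i, c i • u i` in barycentric form. -/
theorem exists_barycentric_eq {n : ℕ} (v : Fin (n + 3) → Fin (n + 2) → ℤ)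
    (p : Fin (n + 2) → ℤ) (u : Fin n → Fin (n + 2) → ℤ)
    (hp : (3 : ℤ) • p = v (Fin.last n).castSucc.castSucc + v (Fin.last (n + 1)).castSucc +
      v (Fin.last (n + 2)))
    (hu : ∀ i : Fin n, (sylv i : ℤ) • u i = v i.castSucc.castSucc.castSucc - p) (c : Fin n → ℝ) :
    ∃ w : Fin (n + 3) → ℝ, ∑ i, w i = 1 ∧
      ∑ i, w i • toR (v i) = toR p + ∑ i, c i • toR (u i) ∧
      (∀ i : Fin n, w i.castSucc.castSucc.castSucc = c i / sylv i) ∧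
      ((∀ i, 0 < c i ∧ c i ≤ 1) → ∀ i, 0 < w i) := by
  have hs (i : ℕ) : (2 : ℝ) ≤ sylv i := by exact_mod_cast two_le_sylv i
  set r : ℝ := (1 - ∑ i, c i / sylv i) / 3 with hr
  refine ⟨Fin.snoc (Fin.snoc (Fin.snoc (fun i => c i / sylv i) r) r) r, ?_, ?_, ?_, ?_⟩
  · simp only [Fin.sum_univ_castSucc, Fin.snoc_castSucc, Fin.snoc_last, hr]
    ring
  · simp only [Fin.sum_univ_castSucc (n := n + 2), Fin.sum_univ_castSucc (n := n + 1),
      Fin.sum_univ_castSucc (n := n), Fin.snoc_castSucc, Fin.snoc_last]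
    ext j
    have hp' : 3 * (p j : ℝ) = v (Fin.last n).castSucc.castSucc j +
        v (Fin.last (n + 1)).castSucc j + v (Fin.last (n + 2)) j := by
      have := congrFun hp j
      simp only [Pi.smul_apply, Pi.add_apply, smul_eq_mul] at this
      exact_mod_cast this
    have hu' (i : Fin n) : c i / sylv i * (v i.castSucc.castSucc.castSucc j : ℝ) =
        c i * u i j + c i / sylv i * p j := by
      have := congrFun (hu i) j
      simp only [Pi.smul_apply, Pi.sub_apply, smul_eq_mul] at this
      have h' : (v i.castSucc.castSucc.castSucc j : ℝ) = sylv i * u i j + p j := by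
        have : v i.castSucc.castSucc.castSucc j = sylv i * u i j + p j := by linarith
        exact_mod_cast this
      have : (sylv i : ℝ) ≠ 0 := by linarith [hs i]
      rw [h']
      field_simp
    simp only [Pi.add_apply, Finset.sum_apply, Pi.smul_apply, smul_eq_mul, toR, hu',
      Finset.sum_add_distrib, ← Finset.sum_mul]
    linear_combination -r * hp' + 3 * (p j : ℝ) * hr
  · simp only [Fin.snoc_castSucc, implies_true]
  · intro hc
    have hrpos : 0 < r := by
      have h1 : ∑ i : Fin n, c i / sylv i ≤ ∑ i : Fin n, ((sylv i : ℝ))⁻¹ := by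
        refine Finset.sum_le_sum fun i _ => ?_
        rw [div_eq_mul_inv]
        exact mul_le_of_le_one_left (by positivity) (hc i).2
      have h2 : ∑ i : Fin n, ((sylv i : ℝ))⁻¹ + ((sylv n : ℝ) - 1)⁻¹ = 1 := sum_inv_sylv n
      have h3 : 0 < ((sylv n : ℝ) - 1)⁻¹ := inv_pos.2 (by linarith [hs n])
      rw [hr]
      linarith
    refine Fin.lastCases ?_ (Fin.lastCases ?_ (Fin.lastCases ?_ fun i => ?_))
    all_goals simp only [Fin.snoc_castSucc, Fin.snoc_last]
    · exact hrpos
    · exact hrpos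
    · exact hrpos
    · exact div_pos (hc i).1 (by linarith [hs i])

theorem toR_add {d : ℕ} (x y : Fin d → ℤ) : toR (x + y) = toR x + toR y := by
  ext j; simp [toR]

theorem toR_zsmul {d : ℕ} (k : ℤ) (x : Fin d → ℤ) : toR (k • x) = (k : ℝ) • toR x := by
  ext j; simp [toR]

theorem toR_sum_zsmul {d : ℕ} {ι : Type*} (s : Finset ι) (m : ι → ℤ) (u : ι → Fin d → ℤ) :
    toR (∑ i ∈ s, m i • u i) = ∑ i ∈ s, (m i : ℝ) • toR (u i) := by
  ext j; simp [toR]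

theorem linearIndependent_directions {n : ℕ} (v : Fin (n + 3) → Fin (n + 2) → ℤ)
    (hv : AffineIndependent ℝ fun i => toR (v i))
    (p : Fin (n + 2) → ℤ) (u : Fin n → Fin (n + 2) → ℤ)
    (hp : (3 : ℤ) • p = v (Fin.last n).castSucc.castSucc + v (Fin.last (n + 1)).castSucc +
      v (Fin.last (n + 2)))
    (hu : ∀ i : Fin n, (sylv i : ℤ) • u i = v i.castSucc.castSucc.castSucc - p) :
    LinearIndependent ℤ u := by
  rw [Fintype.linearIndependent_iff]
  intro m hm i
  obtain ⟨w, hw1, hw2, hw3, -⟩ := exists_barycentric_eq v p u hp hu fun i => m i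
  obtain ⟨w', hw1', hw2', hw3', -⟩ := exists_barycentric_eq v p u hp hu fun _ => 0
  have h0 : ∑ i, (m i : ℝ) • toR (u i) = 0 := by
    rw [← toR_sum_zsmul, hm]
    ext j
    simp [toR]
  have := hv.eq_of_sum_eq_sum (s := Finset.univ) (w₁ := w) (w₂ := w') (by rw [hw1, hw1'])
    (by rw [hw2, hw2', h0]; simp) i.castSucc.castSucc.castSucc (Finset.mem_univ _)
  rw [hw3, hw3', zero_div, div_eq_zero_iff] at this
  have hs : (sylv i : ℝ) ≠ 0 := by
    have := two_le_sylv i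
    exact_mod_cast (by omega : sylv i ≠ 0)
  exact_mod_cast this.resolve_right hs

theorem mem_span_directions_of_smul_mem {n : ℕ} (v : Fin (n + 3) → Fin (n + 2) → ℤ)
    (hv : IsCanonicalSimplex v) (p : Fin (n + 2) → ℤ) (u : Fin n → Fin (n + 2) → ℤ)
    (hp : (3 : ℤ) • p = v (Fin.last n).castSucc.castSucc + v (Fin.last (n + 1)).castSucc +
      v (Fin.last (n + 2)))
    (hu : ∀ i : Fin n, (sylv i : ℤ) • u i = v i.castSucc.castSucc.castSucc - p)
    (hsum : ∑ i, u i = -p) (k : ℤ) (x : Fin (n + 2) → ℤ) (hk : 0 < k)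
    (hx : k • x ∈ Submodule.span ℤ (Set.range u)) : x ∈ Submodule.span ℤ (Set.range u) := by
  obtain ⟨m, hm⟩ := (Submodule.mem_span_range_iff_exists_fun ℤ).1 hx
  set y := x - ∑ i, ((m i - 1) / k) • u i with hy
  have hky : k • y = ∑ i, ((m i - 1) % k + 1) • u i := by
    rw [hy, smul_sub, ← hm, Finset.smul_sum, ← Finset.sum_sub_distrib]
    refine Finset.sum_congr rfl fun i _ => ?_
    rw [smul_smul, ← sub_smul]
    congr 1
    linarith [Int.emod_add_mul_ediv (m i - 1) k]
  have hkR : (0 : ℝ) < k := by exact_mod_cast hk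
  obtain ⟨w, hw1, hw2, -, hw4⟩ :=
    exists_barycentric_eq v p u hp hu fun i => (((m i - 1) % k + 1 : ℤ) : ℝ) / k
  have hyR : toR y = ∑ i, ((((m i - 1) % k + 1 : ℤ) : ℝ) / k) • toR (u i) := by
    have h : (k : ℝ) • toR y = (k : ℝ) • ∑ i, ((((m i - 1) % k + 1 : ℤ) : ℝ) / k) • toR (u i) := by
      rw [← toR_zsmul, hky, toR_sum_zsmul, Finset.smul_sum]
      refine Finset.sum_congr rfl fun i _ => ?_
      rw [smul_smul, mul_div_cancel₀ _ hkR.ne']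
    exact smul_right_injective _ hkR.ne' h
  have hint : toR (p + y) ∈ interior (hullOf v) := by
    rw [toR_add, hyR, ← hw2]
    refine mem_interior_hullOf hv.1 (hw4 fun i => ⟨div_pos ?_ hkR, (div_le_one hkR).2 ?_⟩) hw1
    · exact_mod_cast (by linarith [Int.emod_nonneg (m i - 1) hk.ne'] : 0 < (m i - 1) % k + 1)
    · exact_mod_cast (Int.emod_lt_of_pos (m i - 1) hk : (m i - 1) % k + 1 ≤ k)
  have hyp : y = ∑ i, u i := by
    rw [hsum, eq_neg_iff_add_eq_zero, add_comm y p]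
    exact hv.2.2 _ hint
  have hmem (i) : u i ∈ Submodule.span ℤ (Set.range u) := Submodule.subset_span ⟨i, rfl⟩
  rw [← sub_add_cancel x (∑ i, ((m i - 1) / k) • u i), ← hy, hyp]
  exact add_mem (sum_mem fun i _ => hmem i) (sum_mem fun i _ => Submodule.smul_mem _ _ (hmem i))

/-- If `d ≥ 5` and `S` is a `d`-dimensional canonical lattice simplex whose origin has
barycentric coordinates `(1/s_1, …, 1/s_{d-2}, 1/(3(s_{d-1}-1)), 1/(3(s_{d-1}-1)),
1/(3(s_{d-1}-1)))` with respect to its vertices, then `S` is unimodularly equivalent to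
a lattice simplex `conv{s_1 e_1, …, s_{d-2} e_{d-2}, a, b, c}` with `a + b + c = 0`
containing `e_1 + ⋯ + e_{d-2}` as its unique interior lattice point. -/
theorem canonical_simplex_of_barycentric {d : ℕ} (hd : 5 ≤ d)
    (v : Fin (d + 1) → Fin d → ℤ) (hv : IsCanonicalSimplex v)
    (hbar : ∑ i : Fin (d + 1), (if (i : ℕ) < d - 2 then ((sylv (i : ℕ) : ℚ))⁻¹
        else (3 * ((sylv (d - 2) : ℚ) - 1))⁻¹) • (fun j => (v i j : ℚ)) = 0) :
    ∃ a b c : Fin d → ℤ, a + b + c = 0 ∧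
      AffineIndependent ℝ (fun i => toR (simplexABC d a b c i)) ∧
      UnimodEquiv (hullOf v) (hullOf (simplexABC d a b c)) ∧
      toR (fun j : Fin d => if (j : ℕ) < d - 2 then (1 : ℤ) else 0)
        ∈ interior (hullOf (simplexABC d a b c)) ∧
      ∀ x : Fin d → ℤ, toR x ∈ interior (hullOf (simplexABC d a b c)) →
        x = fun j : Fin d => if (j : ℕ) < d - 2 then (1 : ℤ) else 0 := by
  obtain ⟨n, rfl⟩ : ∃ n, d = n + 2 := ⟨d - 2, by omega⟩
  simp only [Nat.add_sub_cancel] at hbar ⊢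
  have hN (i : Fin n) : ∃ N : ℤ, sylv i * N = (sylv n : ℤ) - 1 :=
    (sylv_dvd_sub_one i.2).imp fun _ h => h.symm
  choose N hN using hN
  have hrel : (3 : ℤ) • ∑ i : Fin n, N i • v i.castSucc.castSucc.castSucc +
      (v (Fin.last n).castSucc.castSucc + v (Fin.last (n + 1)).castSucc +
        v (Fin.last (n + 2))) = 0 := by
    have hn : (sylv n : ℚ) - 1 ≠ 0 := by
      have : (2 : ℚ) ≤ sylv n := by exact_mod_cast two_le_sylv n
      linarith
    ext j
    have h := congrFun hbar j
    simp only [Fin.sum_univ_castSucc (n := n + 2), Fin.sum_univ_castSucc (n := n + 1),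
      Fin.sum_univ_castSucc (n := n), Fin.val_castSucc, Fin.val_last, Fin.is_lt, if_true,
      lt_irrefl, if_false, Nat.not_lt.2 (Nat.le_add_right n _), Finset.sum_apply,
      Pi.smul_apply, smul_eq_mul, Pi.zero_apply] at h
    have hi (i : Fin n) : (N i : ℚ) = (sylv n - 1) * (sylv i : ℚ)⁻¹ := by
      have h1 : (sylv i : ℚ) ≠ 0 := by
        have := two_le_sylv i
        exact_mod_cast (by omega : sylv i ≠ 0)
      rw [eq_mul_inv_iff_mul_eq₀ h1, mul_comm]
      exact_mod_cast hN i
    have h' : 3 * ∑ i : Fin n, (N i : ℚ) * v i.castSucc.castSucc.castSucc j +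
        (v (Fin.last n).castSucc.castSucc j + v (Fin.last (n + 1)).castSucc j +
          v (Fin.last (n + 2)) j) = 0 := by
      simp_rw [hi, mul_assoc, ← Finset.mul_sum]
      have hinv : 3 * ((sylv n : ℚ) - 1) * (3 * ((sylv n : ℚ) - 1))⁻¹ = 1 :=
        mul_inv_cancel₀ (mul_ne_zero three_ne_zero hn)
      linear_combination 3 * ((sylv n : ℚ) - 1) * h - ((v (Fin.last n).castSucc.castSucc j : ℚ) +
        v (Fin.last (n + 1)).castSucc j + v (Fin.last (n + 2)) j) * hinv
    simp only [Pi.add_apply, Finset.sum_apply, Pi.smul_apply, smul_eq_mul, Pi.zero_apply]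
    exact_mod_cast h'
  obtain ⟨p, u, hp, hu, hsum⟩ := exists_centroid_and_directions
    (fun i : Fin n => v i.castSucc.castSucc.castSucc) _ N hN hrel
  obtain ⟨E, hE⟩ := exists_linearEquiv_eq_single u
    (linearIndependent_directions v hv.1 p u hp hu)
    (mem_span_directions_of_smul_mem v hv p u hp hu hsum)
  obtain ⟨A, Φ, hA, hΦ, hΦE⟩ := exists_matrix_of_linearEquiv E (E (-p))
  have hw : E (-p) = fun j : Fin (n + 2) => if (j : ℕ) < n then (1 : ℤ) else 0 := by
    rw [← hsum, map_sum]
    ext j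
    simp only [hE, Finset.sum_apply, Pi.single_apply]
    split_ifs with hj
    · rw [Finset.sum_eq_single ⟨j, hj⟩] <;> simp +contextual [Fin.ext_iff, eq_comm]
    · refine Finset.sum_eq_zero fun i _ => if_neg ?_
      rintro rfl
      exact hj i.2
  have hS : simplexABC (n + 2) (E (v (Fin.last n).castSucc.castSucc) + E (-p))
      (E (v (Fin.last (n + 1)).castSucc) + E (-p)) (E (v (Fin.last (n + 2))) + E (-p)) =
      fun i => E (v i) + E (-p) := by
    funext i
    refine Fin.lastCases ?_ (Fin.lastCases ?_ (Fin.lastCases ?_ fun i => ?_)) i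
    · funext j
      simp [simplexABC]
    · funext j
      simp [simplexABC]
    · funext j
      simp [simplexABC]
    · have h : E (v i.castSucc.castSucc.castSucc) + E (-p) =
          (sylv i : ℤ) • Pi.single (Fin.castAdd 2 i) 1 := by
        rw [← map_add, ← sub_eq_add_neg, ← hu i, map_smul, hE]
      rw [h]
      funext j
      simp [simplexABC, Pi.single_apply, Fin.ext_iff]
  have hcomp : (fun i => toR (E (v i) + E (-p))) = Φ ∘ fun i => toR (v i) :=
    funext fun i => (hΦE (v i)).symm
  have himage : hullOf (fun i => E (v i) + E (-p)) = Φ '' hullOf v := by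
    rw [hullOf, hcomp, Set.range_comp]
    exact (Φ.toAffineMap.image_convexHull _).symm
  have hint : interior (Φ '' hullOf v) = Φ '' interior (hullOf v) :=
    ((AffineEquiv.toContinuousAffineEquiv Φ).toHomeomorph.image_interior _).symm
  refine ⟨E (v (Fin.last n).castSucc.castSucc) + E (-p),
    E (v (Fin.last (n + 1)).castSucc) + E (-p), E (v (Fin.last (n + 2))) + E (-p), ?_, ?_⟩
  · have h := congrArg E hp
    simp only [map_smul, map_add] at h
    rw [map_neg]
    linear_combination (-1 : ℤ) • h
  rw [hS, himage, hint, hcomp, ← hw]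
  refine ⟨Φ.affineIndependent_iff.2 hv.1, ⟨A, E (-p), hA, by rw [hΦ]⟩, ⟨0, hv.2.1, ?_⟩, ?_⟩
  · have h0 : toR (0 : Fin (n + 2) → ℤ) = 0 := by ext; simp [toR]
    rw [← h0, hΦE, map_zero, zero_add]
  · rintro x ⟨z, hz, hzx⟩
    have hx : Φ (toR (E.symm (x - E (-p)))) = toR x := by
      rw [hΦE, E.apply_symm_apply, sub_add_cancel]
    have h := hv.2.2 (E.symm (x - E (-p))) (by rwa [Φ.injective (hx.trans hzx.symm)])
    rwa [LinearEquiv.map_eq_zero_iff, sub_eq_zero] at h
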